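/- arXiv:2010.04439 — 3 statements merged into one kernel-verified Lean document; each statement's English description precedes it below -/
import Mathlib

section
/- Let p be an odd prime and let x₁, x₂, y₁, y₂ be integers. If ⟨x₁⟩_p ≠ (p-1)/2 or ⟨x₂⟩_p ≠ (p-1)/2, then p divides Σ_{k=0}^{p-1} S_k(x₁,y₁)·S_k(x₂,y₂). -/
/-- `S n x y = ∑_{k=0}^{n} C(n,k)·C(x,k)·C(-1-x,k)·y^k` where `C(x,k)` is the
integer-valued binomial coefficient (Mathlib's `Ring.choose`). -/
def S (n : ℕ) (x y : ℤ) : ℤ :=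
  ∑ k ∈ Finset.range (n + 1),
    (n.choose k : ℤ) * Ring.choose x k * Ring.choose (-1 - x) k * y ^ k

/-- A binomial coefficient `C(x, k)` with `x % p < k < p` is divisible by `p`. -/
theorem prime_dvd_ringChoose_of_emod_lt {p : ℕ} (hp : p.Prime) {x : ℤ} {k : ℕ} (hk : k < p)
    (hx : x % p < k) : (p : ℤ) ∣ Ring.choose x k := by
  have : Fact p.Prime := ⟨hp⟩
  have hpos : (0 : ℤ) < p := by exact_mod_cast hp.pos
  obtain ⟨a, ha⟩ := Int.eq_ofNat_of_zero_le (Int.emod_nonneg x hpos.ne')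
  have hdvd : (p : ℤ) ∣ (k.factorial : ℤ) * Ring.choose x k := by
    have h := Ring.descPochhammer_eq_factorial_smul_choose x k
    rw [nsmul_eq_mul] at h
    rw [← h, ← ZMod.intCast_zmod_eq_zero_iff_dvd, ← Polynomial.eval_eq_smeval]
    have hcast : ((x : ℤ) : ZMod p) = (a : ZMod p) := by
      rw [← ZMod.intCast_mod x p, ha]
      simp
    have hev := Polynomial.eval_intCast_map (Int.castRingHom (ZMod p)) (descPochhammer ℤ k) x
    rw [descPochhammer_map, hcast, descPochhammer_eval_eq_descFactorial,
      Nat.descFactorial_of_lt (by omega)] at hev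
    simpa using hev.symm
  rcases (Nat.prime_iff_prime_int.mp hp).dvd_or_dvd hdvd with h | h
  · rw [Int.natCast_dvd_natCast, hp.dvd_factorial] at h
    omega
  · exact h

/-- Modulo an odd prime `p`, the products `C(x, k) * C(-1 - x, k)` with `k < p` vanish beyond
some index `m ≤ (p - 1) / 2`, strictly smaller unless `x % p = (p - 1) / 2`. -/
theorem exists_bound_prime_dvd_choose_mul_choose {p : ℕ} (hp : p.Prime) (hodd : Odd p) (x : ℤ) :
    ∃ m : ℕ, m ≤ (p - 1) / 2 ∧ (x % p ≠ ((p - 1) / 2 : ℕ) → m < (p - 1) / 2) ∧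
      ∀ k < p, m < k → (p : ℤ) ∣ Ring.choose x k * Ring.choose (-1 - x) k := by
  have hpos : (0 : ℤ) < p := by exact_mod_cast hp.pos
  obtain ⟨a, ha⟩ := Int.eq_ofNat_of_zero_le (Int.emod_nonneg x hpos.ne')
  have hap : x % p < p := Int.emod_lt_of_pos x hpos
  have hneg : (-1 - x) % p = p - 1 - a := by
    have hx := Int.emod_add_mul_ediv x p
    rw [show -1 - x = (p - 1 - a : ℤ) + p * (-(x / p) - 1) by linarith, Int.add_mul_emod_self_left,
      Int.emod_eq_of_lt] <;> omega
  obtain ⟨q, hq⟩ := hodd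
  refine ⟨min a (p - 1 - a), by omega, by omega, fun k hk hmk => ?_⟩
  rcases min_lt_iff.mp hmk with h | h
  · exact (prime_dvd_ringChoose_of_emod_lt hp hk (by omega)).mul_right _
  · exact (prime_dvd_ringChoose_of_emod_lt hp hk (by omega)).mul_left _

open Polynomial in
/-- For `n < p`, the residue of `S n x y` modulo `p` is a polynomial in `n` of low degree. -/
theorem exists_polynomial_eval_eq_S {p : ℕ} (hp : p.Prime) (hodd : Odd p) (x y : ℤ) :
    ∃ P : (ZMod p)[X], P.natDegree ≤ (p - 1) / 2 ∧
      (x % p ≠ ((p - 1) / 2 : ℕ) → P.natDegree < (p - 1) / 2) ∧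
      ∀ n < p, P.eval (n : ZMod p) = (S n x y : ZMod p) := by
  have : Fact p.Prime := ⟨hp⟩
  obtain ⟨m, hm, hm', hdvd⟩ := exists_bound_prime_dvd_choose_mul_choose hp hodd x
  let c : ℕ → ZMod p := fun k =>
    ((Ring.choose x k * Ring.choose (-1 - x) k * y ^ k : ℤ) : ZMod p)
  let P : (ZMod p)[X] := ∑ k ∈ Finset.range (m + 1),
    C (c k * (k.factorial : ZMod p)⁻¹) * descPochhammer (ZMod p) k
  have hdeg : P.natDegree ≤ m := by
    refine natDegree_sum_le_of_forall_le _ _ fun k hk => ?_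
    refine (natDegree_C_mul_le _ _).trans ?_
    rw [descPochhammer_natDegree]
    exact Nat.lt_succ_iff.mp (Finset.mem_range.mp hk)
  have hmp : m + 1 ≤ p := by
    have := hp.two_le
    omega
  refine ⟨P, hdeg.trans hm, fun h => hdeg.trans_lt (hm' h), fun n hn => ?_⟩
  have hP : P.eval (n : ZMod p) = ∑ k ∈ Finset.range (m + 1), (n.choose k : ZMod p) * c k := by
    rw [eval_finsetSum]
    refine Finset.sum_congr rfl fun k hk => ?_
    have hk0 : (k.factorial : ZMod p) ≠ 0 := by
      rw [Ne, ZMod.natCast_eq_zero_iff, hp.dvd_factorial]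
      have := Finset.mem_range.mp hk
      omega
    rw [eval_mul, eval_C, descPochhammer_eval_eq_descFactorial,
      Nat.descFactorial_eq_factorial_mul_choose]
    push_cast
    field_simp
  have hS : (S n x y : ZMod p) = ∑ k ∈ Finset.range (n + 1), (n.choose k : ZMod p) * c k := by
    simp only [S, c]
    push_cast
    exact Finset.sum_congr rfl fun k _ => by ring
  rw [hP, hS, Finset.sum_subset (Finset.range_mono hmp),
    Finset.sum_subset (Finset.range_mono (Nat.succ_le_of_lt hn))]
  · intro k _ hk
    rw [Nat.choose_eq_zero_of_lt (by simpa using hk)]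
    simp
  · intro k hk hkm
    have hck : c k = 0 := by
      rw [ZMod.intCast_zmod_eq_zero_iff_dvd]
      exact (hdvd k (Finset.mem_range.mp hk) (by simpa using hkm)).mul_right _
    rw [hck, mul_zero]

open Polynomial in
/-- A polynomial of degree less than `q - 1` over a field with `q` elements sums to zero. -/
theorem FiniteField.sum_eval_eq_zero_of_natDegree_lt {K : Type*} [Field K] [Fintype K] (P : K[X])
    (hP : P.natDegree < Fintype.card K - 1) : ∑ x : K, P.eval x = 0 := by
  simp_rw [eval_eq_sum_range]
  rw [Finset.sum_comm]
  refine Finset.sum_eq_zero fun i hi => ?_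
  rw [← Finset.mul_sum, FiniteField.sum_pow_lt_card_sub_one, mul_zero]
  have := Finset.mem_range.mp hi
  omega

/-- Summing over `ZMod p` amounts to summing over the representatives `0, …, p - 1`. -/
theorem ZMod.sum_range_natCast {p : ℕ} [NeZero p] {M : Type*} [AddCommMonoid M]
    (f : ZMod p → M) : ∑ k ∈ Finset.range p, f k = ∑ x : ZMod p, f x := by
  refine Finset.sum_bij' (fun k _ => (k : ZMod p)) (fun x _ => x.val) ?_ ?_ ?_ ?_ ?_
  · simp
  · simp [ZMod.val_lt]
  · intro k hk
    exact ZMod.val_cast_of_lt (Finset.mem_range.mp hk)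
  · simp
  · simp

theorem stmt_3 (p : ℕ) (hp : p.Prime) (hodd : Odd p)
    (x₁ x₂ y₁ y₂ : ℤ)
    (h : x₁ % p ≠ ((p - 1) / 2 : ℕ) ∨ x₂ % p ≠ ((p - 1) / 2 : ℕ)) :
    (p : ℤ) ∣ ∑ k ∈ Finset.range p, S k x₁ y₁ * S k x₂ y₂ := by
  have : Fact p.Prime := ⟨hp⟩
  obtain ⟨P, hP, hP', hPS⟩ := exists_polynomial_eval_eq_S hp hodd x₁ y₁
  obtain ⟨Q, hQ, hQ', hQS⟩ := exists_polynomial_eval_eq_S hp hodd x₂ y₂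
  have hdeg : (P * Q).natDegree < p - 1 := by
    refine Polynomial.natDegree_mul_le.trans_lt ?_
    rcases h with h | h
    · have := hP' h
      omega
    · have := hQ' h
      omega
  rw [← ZMod.intCast_zmod_eq_zero_iff_dvd,
    ← FiniteField.sum_eval_eq_zero_of_natDegree_lt (P * Q) (by rwa [ZMod.card]),
    ← ZMod.sum_range_natCast]
  push_cast
  refine Finset.sum_congr rfl fun k hk => ?_
  have hk := Finset.mem_range.mp hk
  rw [Polynomial.eval_mul, hPS k hk, hQS k hk]
end

section
/- Let p > 3 be a prime and let a, b be integers with gcd(a,p) = gcd(b,p) = 1. Then, computing in ℤ/pℤ, Σ_{n=0}^{p-1} (Σ_{k=0}^{n} C(n,k)·C(2k,k)·C(3k,k)·(a⁻¹)^k)·(Σ_{k=0}^{n} C(n,k)·C(2k,k)·C(4k,2k)·(b⁻¹)^k) = 0. -/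
open Polynomial in
/-- A polynomial of degree less than `p - 1` sums to zero over a complete residue system. -/
lemma sum_range_eval_eq_zero_of_natDegree_lt (p : ℕ) [Fact p.Prime] (f : (ZMod p)[X])
    (hf : f.natDegree < p - 1) : ∑ n ∈ Finset.range p, f.eval (n : ZMod p) = 0 := by
  have h : ∀ i ∈ Finset.range (f.natDegree + 1),
      ∑ n ∈ Finset.range p, f.coeff i * (n : ZMod p) ^ i = 0 := by
    intro i hi
    have hsum : ∑ n ∈ Finset.range p, (n : ZMod p) ^ i = ∑ x : ZMod p, x ^ i := by
      refine Finset.sum_bij (fun n _ => (n : ZMod p)) (fun _ _ => Finset.mem_univ _) ?_ ?_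
        (fun _ _ => rfl)
      · intro m hm n hn hmn
        rw [ZMod.natCast_eq_natCast_iff'] at hmn
        rwa [Nat.mod_eq_of_lt (Finset.mem_range.1 hm),
          Nat.mod_eq_of_lt (Finset.mem_range.1 hn)] at hmn
      · intro x _
        exact ⟨x.val, Finset.mem_range.2 x.val_lt, ZMod.natCast_zmod_val x⟩
    rw [← Finset.mul_sum, hsum, FiniteField.sum_pow_lt_card_sub_one, mul_zero]
    rw [ZMod.card]
    have := Finset.mem_range.1 hi
    omega
  simp_rw [eval_eq_sum_range]
  rw [Finset.sum_comm]
  exact Finset.sum_eq_zero h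

open Polynomial in
/-- A binomial transform modulo `p` whose coefficients vanish from `p / m` on is given by a
polynomial of degree at most `(p - 1) / m`. -/
lemma exists_polynomial_eval_eq_sum_choose (p m : ℕ) [Fact p.Prime] (hm : 0 < m)
    (c : ℕ → ZMod p) (hc : ∀ k < p, p ≤ m * k → c k = 0) :
    ∃ f : (ZMod p)[X], f.natDegree ≤ (p - 1) / m ∧ ∀ n < p,
      ∑ k ∈ Finset.range (n + 1), (n.choose k : ZMod p) * c k = f.eval (n : ZMod p) := by
  refine ⟨∑ k ∈ Finset.range p, C (c k * (k.factorial : ZMod p)⁻¹) * descPochhammer (ZMod p) k,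
    natDegree_sum_le_of_forall_le _ _ fun k hk => ?_, fun n hn => ?_⟩
  · by_cases h : p ≤ m * k
    · simp [hc k (Finset.mem_range.1 hk) h]
    · refine (natDegree_C_mul_le _ _).trans ?_
      rw [descPochhammer_natDegree, Nat.le_div_iff_mul_le hm, mul_comm]
      omega
  · rw [eval_finsetSum]
    have hsub : Finset.range (n + 1) ⊆ Finset.range p := Finset.range_subset_range.2 hn
    rw [Finset.sum_subset hsub fun k _ hk => by
      rw [Nat.choose_eq_zero_of_lt (by simpa using hk), Nat.cast_zero, zero_mul]]
    refine Finset.sum_congr rfl fun k hk => ?_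
    have hk0 : (k.factorial : ZMod p) ≠ 0 := by
      rw [Ne, ZMod.natCast_eq_zero_iff, (Fact.out : p.Prime).dvd_factorial]
      exact not_le.2 (Finset.mem_range.1 hk)
    rw [eval_mul, eval_C, descPochhammer_eval_eq_descFactorial,
      Nat.descFactorial_eq_factorial_mul_choose, Nat.cast_mul]
    field_simp

/-- For `k < p ≤ (i + 2) * k` with `i ≤ 2`, the prime `p` divides
`C(2k, k) * C((i + 2) k, i k)`. -/
lemma Nat.Prime.dvd_centralBinom_mul_choose {p : ℕ} (hp : p.Prime) {i k : ℕ} (hi : i ≤ 2)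
    (hk : k < p) (h : p ≤ i * k + 2 * k) :
    p ∣ (2 * k).choose k * (i * k + 2 * k).choose (i * k) := by
  by_cases h2 : p ≤ 2 * k
  · refine Dvd.dvd.mul_right ?_ _
    rw [two_mul] at h2 ⊢
    exact hp.dvd_choose_add hk hk h2
  · have : i * k ≤ 2 * k := Nat.mul_le_mul_right k hi
    exact (hp.dvd_choose_add (by omega) (by omega) h).mul_left _

theorem stmt_8 (p : ℕ) [Fact (Nat.Prime p)] (hp3 : 3 < p)
    (a b : ℤ) (hap : Int.gcd a p = 1) (hbp : Int.gcd b p = 1) :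
    ∑ n ∈ Finset.range p,
        (∑ k ∈ Finset.range (n + 1),
          (n.choose k : ZMod p) * ((2 * k).choose k : ZMod p) *
            ((3 * k).choose k : ZMod p) * ((a : ZMod p)⁻¹) ^ k) *
        (∑ k ∈ Finset.range (n + 1),
          (n.choose k : ZMod p) * ((2 * k).choose k : ZMod p) *
            ((4 * k).choose (2 * k) : ZMod p) * ((b : ZMod p)⁻¹) ^ k) = 0 := by
  have hp : p.Prime := Fact.out
  obtain ⟨f, hf, hf'⟩ := exists_polynomial_eval_eq_sum_choose p 3 (by norm_num)
    (fun k => (((2 * k).choose k * (3 * k).choose k : ℕ) : ZMod p) * ((a : ZMod p)⁻¹) ^ k)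
    fun k hk h => by
      have hd := hp.dvd_centralBinom_mul_choose (i := 1) (by norm_num) hk (by omega)
      rw [← add_mul, one_mul] at hd
      rw [(ZMod.natCast_eq_zero_iff _ _).2 hd, zero_mul]
  obtain ⟨g, hg, hg'⟩ := exists_polynomial_eval_eq_sum_choose p 4 (by norm_num)
    (fun k => (((2 * k).choose k * (4 * k).choose (2 * k) : ℕ) : ZMod p) * ((b : ZMod p)⁻¹) ^ k)
    fun k hk h => by
      have hd := hp.dvd_centralBinom_mul_choose (i := 2) le_rfl hk (by omega)
      rw [← add_mul] at hd
      rw [(ZMod.natCast_eq_zero_iff _ _).2 hd, zero_mul]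
  have hfg : (f * g).natDegree < p - 1 := Polynomial.natDegree_mul_le.trans_lt (by omega)
  rw [← sum_range_eval_eq_zero_of_natDegree_lt p (f * g) hfg]
  refine Finset.sum_congr rfl fun n hn => ?_
  rw [Polynomial.eval_mul, ← hf' n (Finset.mem_range.1 hn), ← hg' n (Finset.mem_range.1 hn)]
  simp only [Nat.cast_mul, mul_assoc]
end

section
/- Let p > 3 be a prime. Then, computing in ℤ/pℤ, Σ_{n=0}^{p-1} (Σ_{k=0}^{n} C(n,k)·C_k·(2⁻¹)^k)² = 4·(-1/p) − 6·(3/p) + 3, where (·/p) is the Legendre symbol. -/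
open Polynomial in
/-- The sum of the values of a polynomial of degree less than `2 * (p - 1)` over `ZMod p`
is minus its coefficient of degree `p - 1`. -/
theorem ZMod.sum_eval_of_natDegree_lt (p : ℕ) [Fact p.Prime] (f : (ZMod p)[X])
    (hf : f.natDegree < 2 * (p - 1)) :
    ∑ x : ZMod p, f.eval x = -f.coeff (p - 1) := by
  have hp : 1 < p := (Fact.out : p.Prime).one_lt
  have hpow : ∀ i < 2 * (p - 1), ∑ x : ZMod p, x ^ i = if i = p - 1 then -1 else 0 := by
    intro i hi
    split_ifs with h
    · have hx : ∀ x : ZMod p, x ^ i = 1 - if x = 0 then 1 else 0 := by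
        intro x
        by_cases hx : x = 0
        · simp [hx, h]; omega
        · simp [hx, h, ZMod.pow_card_sub_one_eq_one hx]
      simp [hx, Finset.sum_sub_distrib]
    · by_cases h' : i < p - 1
      · exact FiniteField.sum_pow_lt_card_sub_one (ZMod p) i (by simpa [ZMod.card] using h')
      · have hx : ∀ x : ZMod p, x ^ i = x ^ (i - (p - 1)) := by
          intro x
          by_cases hx : x = 0
          · rw [hx, zero_pow (by omega), zero_pow (by omega)]
          · conv_lhs => rw [← Nat.sub_add_cancel (Nat.le_of_not_lt h'), pow_add,
              ZMod.pow_card_sub_one_eq_one hx, mul_one]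
        simp_rw [hx]
        exact FiniteField.sum_pow_lt_card_sub_one (ZMod p) _ (by rw [ZMod.card]; omega)
  simp_rw [eval_eq_sum_range' hf]
  rw [Finset.sum_comm]
  simp_rw [← Finset.mul_sum]
  rw [Finset.sum_congr rfl fun i hi => by rw [hpow i (Finset.mem_range.mp hi)]]
  simp only [mul_ite, mul_neg, mul_one, mul_zero, Finset.sum_ite_eq', Finset.mem_range]
  rw [if_pos (by omega)]

open Polynomial in
/-- Euler-criterion sum of a linear form against a quadratic in completed-square form. -/
theorem ZMod.sum_linear_mul_quadratic_pow (p : ℕ) [Fact p.Prime] (hp : 2 < p)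
    (a e h α β : ZMod p) :
    ∑ s : ZMod p, (α + β * s) * (a * (s - h) ^ 2 + e) ^ (p / 2) =
      -(α + β * h) * a ^ (p / 2) := by
  have hodd : p % 2 = 1 := (Fact.out : p.Prime).eq_two_or_odd.resolve_left (by omega)
  have two_ne : (2 : ZMod p) ≠ 0 := by
    have : ((2 : ℕ) : ZMod p) ≠ 0 := by
      rw [Ne, ZMod.natCast_eq_zero_iff]
      exact fun hd => absurd (Nat.le_of_dvd (by norm_num) hd) (by omega)
    exact_mod_cast this
  have even : ∑ v : ZMod p, (a * v ^ 2 + e) ^ (p / 2) = -a ^ (p / 2) := by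
    have hd : (C a * X ^ 2 + C e).natDegree ≤ 2 := by compute_degree
    have := ZMod.sum_eval_of_natDegree_lt p ((C a * X ^ 2 + C e) ^ (p / 2))
      (lt_of_le_of_lt (natDegree_pow_le_of_le _ hd) (by omega))
    rw [show p - 1 = (p / 2) * 2 by omega, coeff_pow_of_natDegree_le hd] at this
    simpa [coeff_C] using this
  have odd : ∑ v : ZMod p, v * (a * v ^ 2 + e) ^ (p / 2) = 0 := by
    have h1 := Equiv.sum_comp (Equiv.neg (ZMod p)) fun v => v * (a * v ^ 2 + e) ^ (p / 2)
    simp only [Equiv.neg_apply, neg_sq, neg_mul, Finset.sum_neg_distrib] at h1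
    have : (2 : ZMod p) * ∑ v : ZMod p, v * (a * v ^ 2 + e) ^ (p / 2) = 0 := by
      linear_combination -h1
    exact (mul_eq_zero.mp this).resolve_left two_ne
  rw [← Equiv.sum_comp (Equiv.addRight h)]
  have : ∀ v : ZMod p, (α + β * (Equiv.addRight h v)) *
      (a * ((Equiv.addRight h v) - h) ^ 2 + e) ^ (p / 2) =
      (α + β * h) * (a * v ^ 2 + e) ^ (p / 2) + β * (v * (a * v ^ 2 + e) ^ (p / 2)) := by
    intro v
    simp only [Equiv.coe_addRight, add_sub_cancel_right]
    ring
  simp_rw [this, Finset.sum_add_distrib, ← Finset.mul_sum, even, odd]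
  ring

theorem add_two_mul_catalan_succ (k : ℕ) :
    (k + 2) * catalan (k + 1) = 2 * (2 * k + 1) * catalan k := by
  have h1 := Nat.succ_mul_centralBinom_succ k
  rw [← succ_mul_catalan_eq_centralBinom, ← succ_mul_catalan_eq_centralBinom] at h1
  apply Nat.eq_of_mul_eq_mul_left (Nat.succ_pos k)
  simp only [Nat.succ_eq_add_one]
  linarith

section

variable (p : ℕ) [Fact p.Prime]

theorem ZMod.natCast_ne_zero_of_lt {a : ℕ} (h0 : 0 < a) (ha : a < p) : (a : ZMod p) ≠ 0 := by
  rw [Ne, ZMod.natCast_eq_zero_iff]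
  exact fun hd => absurd (Nat.le_of_dvd h0 hd) (by omega)

/-- Catalan numbers modulo `p` through binomial coefficients with upper index `(p + 1) / 2`,
which is `1 / 2` modulo `p`. -/
theorem catalan_eq_choose_half (hp : 2 < p) (k : ℕ) (hk : k + 1 < p) :
    (catalan k : ZMod p) = 2 * (-4) ^ k * ((p / 2 + 1).choose (k + 1) : ZMod p) := by
  have hodd : p % 2 = 1 := (Fact.out : p.Prime).eq_two_or_odd.resolve_left (by omega)
  have hm : (2 : ZMod p) * ((p / 2 + 1 : ℕ) : ZMod p) = 1 := by
    have : 2 * (p / 2 + 1) = p + 1 := by omega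
    have := congrArg (Nat.cast : ℕ → ZMod p) this
    simpa using this
  induction k with
  | zero => simpa using hm.symm
  | succ k ih =>
    have hk2 : ((k + 2 : ℕ) : ZMod p) ≠ 0 := ZMod.natCast_ne_zero_of_lt p (by omega) (by omega)
    apply mul_left_cancel₀ hk2
    have hc := congrArg (Nat.cast : ℕ → ZMod p) (add_two_mul_catalan_succ k)
    have hb : ((p / 2 + 1).choose (k + 2) : ZMod p) * ((k + 2 : ℕ) : ZMod p) =
        ((p / 2 + 1).choose (k + 1) : ZMod p) * (((p / 2 + 1 : ℕ) : ZMod p) - (k + 1)) := by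
      have := congrArg (Nat.cast : ℕ → ZMod p) (Nat.choose_succ_right_eq (p / 2 + 1) (k + 1))
      rw [Nat.cast_mul, Nat.cast_mul] at this
      rw [this]
      by_cases hle : k + 1 ≤ p / 2 + 1
      · rw [Nat.cast_sub hle]; push_cast; ring
      · rw [Nat.choose_eq_zero_of_lt (by omega)]; simp
    have ih' := ih (by omega)
    rw [show k + 1 + 1 = k + 2 from rfl]
    generalize ((p / 2 + 1).choose (k + 2) : ZMod p) = B at hb ⊢
    generalize ((p / 2 + 1).choose (k + 1) : ZMod p) = A at hb ih'
    generalize ((p / 2 + 1 : ℕ) : ZMod p) = M at hb hm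
    push_cast at hc hb ⊢
    rw [hc, ih', pow_succ]
    linear_combination (8 * (-4) ^ k) * hb + (4 * (-4) ^ k * A) * hm

theorem catalan_prime_sub_one (hp : 2 < p) : (catalan (p - 1) : ZMod p) = -1 := by
  have h1 := add_two_mul_catalan_succ (p - 1)
  have h2 := succ_mul_catalan_eq_centralBinom p
  rw [Nat.sub_add_cancel (by omega), show p - 1 + 2 = p + 1 by omega, h2] at h1
  have h3 : (p.centralBinom : ZMod p) = 2 := by
    have := (ZMod.natCast_eq_natCast_iff _ _ _).mpr
      (Choose.choose_modEq_choose_mod_mul_choose_div_nat (n := 2 * p) (k := p) (p := p))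
    rw [Nat.centralBinom, this]
    simp [Nat.div_self (show 0 < p by omega), Nat.mul_div_cancel _ (show 0 < p by omega)]
  have h4 := congrArg (Nat.cast : ℕ → ZMod p) h1
  rw [h3] at h4
  push_cast [Nat.cast_sub (show 1 ≤ p by omega)] at h4
  rw [ZMod.natCast_self] at h4
  have two_ne : (2 : ZMod p) ≠ 0 := by
    exact_mod_cast ZMod.natCast_ne_zero_of_lt p (a := 2) (by norm_num) hp
  apply mul_left_cancel₀ two_ne
  linear_combination h4

open Polynomial in
/-- Scaled Catalan numbers as moments over `ZMod p`. -/
theorem catalan_mul_inv_two_pow_eq_sum (hp : 3 < p) (k : ℕ) (hk : k < p) :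
    (catalan k : ZMod p) * (2 : ZMod p)⁻¹ ^ k =
      -∑ w : ZMod p, w ^ k * ((2 - w) * (w * (w - 2)) ^ (p / 2)) +
        ((if k = p - 2 then 1 else 0) - if k = p - 1 then 2 else 0) := by
  have hodd : p % 2 = 1 := (Fact.out : p.Prime).eq_two_or_odd.resolve_left (by omega)
  have two_ne : (2 : ZMod p) ≠ 0 := by
    exact_mod_cast ZMod.natCast_ne_zero_of_lt p (a := 2) (by norm_num) (by omega)
  have hdeg : ∀ a b : ℕ, (X ^ a * (X + C (-2 : ZMod p)) ^ b).natDegree = a + b := by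
    intro a b
    rw [natDegree_mul (pow_ne_zero _ X_ne_zero) (pow_ne_zero _ (X_add_C_ne_zero _)),
      natDegree_pow, natDegree_pow, natDegree_X, natDegree_X_add_C, mul_one, mul_one]
  rcases lt_trichotomy k (p - 2) with h | h | h
  · rw [if_neg (by omega), if_neg (by omega), sub_zero, add_zero]
    have hs := ZMod.sum_eval_of_natDegree_lt p
      (X ^ (p / 2 + k) * (X + C (-2 : ZMod p)) ^ (p / 2 + 1)) (by rw [hdeg]; omega)
    have hw : ∀ w : ZMod p, w ^ k * ((2 - w) * (w * (w - 2)) ^ (p / 2)) =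
        -eval w (X ^ (p / 2 + k) * (X + C (-2 : ZMod p)) ^ (p / 2 + 1)) := by
      intro w
      simp only [eval_mul, eval_pow, eval_X, eval_add, eval_C]
      rw [mul_pow]
      ring
    simp_rw [hw, Finset.sum_neg_distrib, hs, neg_neg]
    rw [catalan_eq_choose_half p (by omega) k (by omega), coeff_X_pow_mul']
    split_ifs with hle
    · rw [coeff_X_add_C_pow, show p / 2 + 1 - (p - 1 - (p / 2 + k)) = k + 1 by omega,
        ← Nat.choose_symm (show k + 1 ≤ p / 2 + 1 by omega),
        show p / 2 + 1 - (k + 1) = p - 1 - (p / 2 + k) by omega,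
        show (-4 : ZMod p) ^ k = (-2) ^ k * 2 ^ k by rw [← mul_pow]; norm_num]
      have : (2 : ZMod p) ^ k * 2⁻¹ ^ k = 1 := by rw [← mul_pow, mul_inv_cancel₀ two_ne, one_pow]
      generalize ((p / 2 + 1).choose _ : ZMod p) = B
      linear_combination (2 * (-2) ^ k * B) * this
    · rw [Nat.choose_eq_zero_of_lt (by omega)]; simp
  · have hs := ZMod.sum_eval_of_natDegree_lt p
      (X ^ (p / 2 - 1) * (X + C (-2 : ZMod p)) ^ (p / 2 + 1)) (by rw [hdeg]; omega)
    have hm : (X ^ (p / 2 - 1) * (X + C (-2 : ZMod p)) ^ (p / 2 + 1)).coeff (p - 1) = 1 := by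
      rw [show p - 1 = (X ^ (p / 2 - 1) * (X + C (-2 : ZMod p)) ^ (p / 2 + 1)).natDegree by
        rw [hdeg]; omega]
      exact ((monic_X_pow _).mul ((monic_X_add_C _).pow _)).coeff_natDegree
    have hw : ∀ w : ZMod p, w ^ k * ((2 - w) * (w * (w - 2)) ^ (p / 2)) =
        -eval w (X ^ (p / 2 - 1) * (X + C (-2 : ZMod p)) ^ (p / 2 + 1)) := by
      intro w
      simp only [eval_mul, eval_pow, eval_X, eval_add, eval_C]
      have : w ^ k * w ^ (p / 2) = w ^ (p / 2 - 1) := by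
        by_cases h0 : w = 0
        · rw [h0, zero_pow (show p / 2 ≠ 0 by omega), zero_pow (show p / 2 - 1 ≠ 0 by omega),
            mul_zero]
        · rw [← pow_add, show k + p / 2 = (p - 1) + (p / 2 - 1) by omega, pow_add,
            ZMod.pow_card_sub_one_eq_one h0, one_mul]
      rw [mul_pow, ← this]
      ring
    simp_rw [hw, Finset.sum_neg_distrib, hs, hm]
    rw [catalan_eq_choose_half p (by omega) k (by omega), Nat.choose_eq_zero_of_lt (by omega),
      if_pos h, if_neg (by omega)]
    simp
  · have hk' : k = p - 1 := by omega
    have hw : ∀ w : ZMod p, w ^ k * ((2 - w) * (w * (w - 2)) ^ (p / 2)) =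
        (2 + (-1) * w) * (1 * (w - 1) ^ 2 + (-1)) ^ (p / 2) := by
      intro w
      rw [show 1 * (w - 1) ^ 2 + (-1) = w * (w - 2) by ring]
      by_cases h0 : w = 0
      · rw [h0, zero_mul, zero_pow (show p / 2 ≠ 0 by omega)]; ring
      · rw [hk', ZMod.pow_card_sub_one_eq_one h0]; ring
    simp_rw [hw]
    rw [ZMod.sum_linear_mul_quadratic_pow p (by omega), hk', catalan_prime_sub_one p (by omega),
      ZMod.pow_card_sub_one_eq_one (inv_ne_zero two_ne), if_neg (by omega), if_pos rfl]
    norm_num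

/-- The binomial transform of the scaled Catalan numbers as moments over `ZMod p`. -/
theorem sum_choose_mul_catalan_eq_sum (hp : 3 < p) (n : ℕ) (hn : n < p) :
    ∑ k ∈ Finset.range (n + 1),
        (n.choose k : ZMod p) * (catalan k : ZMod p) * ((2 : ZMod p)⁻¹) ^ k =
      -∑ s : ZMod p, s ^ n * ((3 - s) * ((s - 1) * (s - 3)) ^ (p / 2)) +
        ((if n = p - 2 then 1 else 0) - if n = p - 1 then 3 else 0) := by
  have hterm : ∀ k ∈ Finset.range (n + 1),
      (n.choose k : ZMod p) * (catalan k : ZMod p) * ((2 : ZMod p)⁻¹) ^ k =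
      -∑ w : ZMod p, (n.choose k : ZMod p) * w ^ k * ((2 - w) * (w * (w - 2)) ^ (p / 2)) +
        ((if k = p - 2 then (n.choose (p - 2) : ZMod p) else 0) -
          if k = p - 1 then (n.choose (p - 1) : ZMod p) * 2 else 0) := by
    intro k hk
    have hk' := Finset.mem_range.mp hk
    rw [mul_assoc, catalan_mul_inv_two_pow_eq_sum p hp k (by omega), mul_add, mul_neg,
      Finset.mul_sum]
    congr 1
    · simp_rw [mul_assoc]
    · by_cases h1 : k = p - 2
      · rw [if_pos h1, if_pos h1, if_neg (by omega), if_neg (by omega), h1]; ring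
      · rw [if_neg h1, if_neg h1]
        split_ifs with h2
        · rw [h2]; ring
        · ring
  rw [Finset.sum_congr rfl hterm, Finset.sum_add_distrib, Finset.sum_neg_distrib,
    Finset.sum_comm]
  congr 1
  · congr 1
    rw [← Equiv.sum_comp (Equiv.addRight (1 : ZMod p))
      fun s => s ^ n * ((3 - s) * ((s - 1) * (s - 3)) ^ (p / 2))]
    refine Finset.sum_congr rfl fun w _ => ?_
    dsimp only [Equiv.coe_addRight]
    rw [← Finset.sum_mul, add_pow]
    congr 1
    · exact Finset.sum_congr rfl fun k _ => by ring
    · congr 1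
      · ring
      · congr 1; ring
  · rw [Finset.sum_sub_distrib, Finset.sum_ite_eq', Finset.sum_ite_eq']
    simp only [Finset.mem_range]
    rcases lt_trichotomy n (p - 2) with h | h | h
    · rw [if_neg (by omega), if_neg (by omega), if_neg (by omega), if_neg (by omega)]
    · rw [if_pos (by omega), if_neg (by omega), if_pos h, if_neg (by omega), h, Nat.choose_self]
      simp
    · have h' : n = p - 1 := by omega
      rw [if_pos (by omega), if_pos (by omega), if_neg (by omega), if_pos h', h', Nat.choose_self]
      have hc : (p - 1).choose (p - 2) = p - 1 := by
        rw [show p - 1 = (p - 2) + 1 by omega, Nat.choose_succ_self_right]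
      rw [hc, Nat.cast_sub (by omega), ZMod.natCast_self]
      norm_num

/-- The Euler-criterion power is insensitive to nonzero square factors. -/
theorem ZMod.mul_sq_pow_half (hp : 2 < p) (a : ZMod p) {s : ZMod p} (hs : s ≠ 0) :
    (a * s ^ 2) ^ (p / 2) = a ^ (p / 2) := by
  have hodd : p % 2 = 1 := (Fact.out : p.Prime).eq_two_or_odd.resolve_left (by omega)
  rw [mul_pow, ← pow_mul, show 2 * (p / 2) = p - 1 by omega, ZMod.pow_card_sub_one_eq_one hs,
    mul_one]

/-- Sum of the squares of the moments of a function on `ZMod p`. -/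
theorem ZMod.sum_sq_moments (g : ZMod p → ZMod p) :
    ∑ n ∈ Finset.range p, (∑ s : ZMod p, s ^ n * g s) ^ 2 =
      (∑ s, g s) ^ 2 - ∑ s : ZMod p, if s = 0 then 0 else g s * g s⁻¹ := by
  have hgeom : ∀ x : ZMod p, ∑ n ∈ Finset.range p, x ^ n = 1 - if x = 1 then 1 else 0 := by
    intro x
    split_ifs with h
    · simp [h]
    · have h' := sub_ne_zero.mpr h
      have := geom_sum_mul x p
      rw [ZMod.pow_card] at this
      rw [sub_zero]
      exact mul_right_cancel₀ h' (by rw [this, one_mul])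
  have h1 : ∀ n, (∑ s : ZMod p, s ^ n * g s) ^ 2 =
      ∑ s : ZMod p, ∑ t : ZMod p, g s * g t * (s * t) ^ n := by
    intro n
    rw [sq, Finset.sum_mul_sum]
    refine Finset.sum_congr rfl fun s _ => Finset.sum_congr rfl fun t _ => ?_
    rw [mul_pow]; ring
  simp_rw [h1]
  rw [Finset.sum_comm, sq, Finset.sum_mul_sum, ← Finset.sum_sub_distrib]
  refine Finset.sum_congr rfl fun s _ => ?_
  rw [Finset.sum_comm]
  simp_rw [← Finset.mul_sum, hgeom, mul_sub, mul_one, Finset.sum_sub_distrib]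
  rw [← Finset.mul_sum]
  congr 1
  by_cases hs : s = 0
  · simp [hs]
  · rw [if_neg hs]
    have : ∀ t : ZMod p, s * t = 1 ↔ t = s⁻¹ := fun t => by
      rw [mul_comm]; exact mul_eq_one_iff_eq_inv₀ hs
    simp [this]

end

theorem stmt_12 (p : ℕ) [Fact (Nat.Prime p)] (hp3 : 3 < p) :
    ∑ n ∈ Finset.range p,
        (∑ k ∈ Finset.range (n + 1),
          (n.choose k : ZMod p) * (catalan k : ZMod p) * ((2 : ZMod p)⁻¹) ^ k) ^ 2 =
      4 * (legendreSym p (-1) : ZMod p) - 6 * (legendreSym p 3 : ZMod p) + 3 := by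
  have hp2 : 2 < p := by omega
  have hodd : p % 2 = 1 := (Fact.out : p.Prime).eq_two_or_odd.resolve_left (by omega)
  have two_ne : (2 : ZMod p) ≠ 0 := by
    exact_mod_cast ZMod.natCast_ne_zero_of_lt p (a := 2) (by norm_num) (by omega)
  have three_ne : (3 : ZMod p) ≠ 0 := by
    exact_mod_cast ZMod.natCast_ne_zero_of_lt p (a := 3) (by norm_num) (by omega)
  have three_inv : (3 : ZMod p) * 3⁻¹ = 1 := mul_inv_cancel₀ three_ne
  have hm0 : p / 2 ≠ 0 := by omega
  rw [legendreSym.eq_pow, legendreSym.eq_pow]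
  push_cast
  have chi3_sq : ((3 : ZMod p) ^ (p / 2)) ^ 2 = 1 := by
    rw [← pow_mul, show p / 2 * 2 = p - 1 by omega, ZMod.pow_card_sub_one_eq_one three_ne]
  set g : ZMod p → ZMod p := fun s => (3 - s) * ((s - 1) * (s - 3)) ^ (p / 2) with hg
  set b : ℕ → ZMod p := fun n => ∑ s : ZMod p, s ^ n * g s with hb
  have g_sum : ∑ s, g s = -1 := by
    have : ∀ s, g s = (3 + (-1) * s) * (1 * (s - 2) ^ 2 + (-1)) ^ (p / 2) := by
      intro s
      rw [hg, show 1 * (s - 2) ^ 2 + (-1) = (s - 1) * (s - 3) by ring]; ring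
    simp_rw [this]
    rw [ZMod.sum_linear_mul_quadratic_pow p hp2]
    norm_num
  have b_top : b (p - 1) = -1 - 3 * 3 ^ (p / 2) := by
    have : ∀ s : ZMod p, s ^ (p - 1) * g s = g s - if s = 0 then 3 * 3 ^ (p / 2) else 0 := by
      intro s
      split_ifs with h
      · rw [h, zero_pow (by omega), hg]; norm_num
      · rw [ZMod.pow_card_sub_one_eq_one h]; ring
    simp only [hb]
    rw [Finset.sum_congr rfl fun s _ => this s, Finset.sum_sub_distrib, g_sum]
    simp
  have b_pred : b (p - 2) = 1 - 3 ^ (p / 2) := by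
    have : ∀ s : ZMod p, (s⁻¹) ^ (p - 2) * g s⁻¹ =
        ((-1) + 3 * s) * (3 * (s - 2 * 3⁻¹) ^ 2 + (-3⁻¹)) ^ (p / 2) +
          if s = 0 then 1 else 0 := by
      intro s
      rw [show 3 * (s - 2 * 3⁻¹) ^ 2 + (-3⁻¹) = (1 - s) * (1 - 3 * s) by
        linear_combination (-4 * s + 4 * 3⁻¹ + 1) * three_inv]
      split_ifs with h
      · rw [h, inv_zero, zero_pow (by omega)]; norm_num
      · have hinv : (s⁻¹) ^ (p - 2) = s := by
          have h1 := ZMod.pow_card_sub_one_eq_one (inv_ne_zero h)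
          rw [show p - 1 = (p - 2) + 1 by omega, pow_succ] at h1
          exact (eq_inv_of_mul_eq_one_left h1).trans (inv_inv s)
        rw [hinv, hg]
        dsimp only
        rw [← ZMod.mul_sq_pow_half p hp2 ((s⁻¹ - 1) * (s⁻¹ - 3)) h,
          show (s⁻¹ - 1) * (s⁻¹ - 3) * s ^ 2 = (1 - s) * (1 - 3 * s) by field_simp,
          ← mul_assoc, show s * (3 - s⁻¹) = -1 + 3 * s by field_simp; ring]
        ring
    simp only [hb]
    rw [← Equiv.sum_comp (Equiv.inv (ZMod p))]
    simp only [Equiv.inv_apply]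
    rw [Finset.sum_congr rfl fun s _ => this s, Finset.sum_add_distrib,
      ZMod.sum_linear_mul_quadratic_pow p hp2]
    simp only [Finset.sum_ite_eq', Finset.mem_univ, if_true]
    linear_combination (-2 * 3 ^ (p / 2)) * three_inv
  have corr : ∑ s : ZMod p, (if s = 0 then 0 else g s * g s⁻¹) =
      -10 * 3 ^ (p / 2) - 4 * (-1) ^ (p / 2) := by
    set Q : ZMod p → ZMod p := fun s => (s - 3) * (3 * s - 1) with hQ
    have hpt : ∀ s : ZMod p, (if s = 0 then 0 else g s * g s⁻¹) =
        (10 - 3 * s) * Q s ^ (p / 2) - 3 * (s⁻¹ * Q s ^ (p / 2)) -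
          (if s = 0 then 10 * 3 ^ (p / 2) else 0) -
          (if s = 1 then 4 * (-1) ^ (p / 2) else 0) := by
      intro s
      by_cases h : s = 0
      · simp [h, hQ]
      rw [if_neg h, if_neg h]
      by_cases h1 : s = 1
      · have h4 : Q 1 ^ (p / 2) = (-1) ^ (p / 2) := by
          rw [← ZMod.mul_sq_pow_half p hp2 (-1) two_ne, hQ]
          norm_num
        rw [h1, inv_one, h4, if_pos rfl]
        simp [hg, hm0]
        ring
      · rw [if_neg h1, hg]
        dsimp only
        have hs1 : s - 1 ≠ 0 := sub_ne_zero.mpr h1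
        have e : ((s - 1) * (s - 3)) ^ (p / 2) * ((s⁻¹ - 1) * (s⁻¹ - 3)) ^ (p / 2) =
            Q s ^ (p / 2) := by
          rw [← mul_pow, ← ZMod.mul_sq_pow_half p hp2 _ h,
            ← ZMod.mul_sq_pow_half p hp2 (Q s) hs1, hQ]
          congr 1
          field_simp
          ring
        have e2 : (3 - s) * (3 - s⁻¹) = 10 - 3 * s - 3 * s⁻¹ := by field_simp; ring
        linear_combination ((3 - s) * (3 - s⁻¹)) * e + Q s ^ (p / 2) * e2
    have hinv : ∑ s : ZMod p, s⁻¹ * Q s ^ (p / 2) = ∑ s : ZMod p, s * Q s ^ (p / 2) := by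
      rw [← Equiv.sum_comp (Equiv.inv (ZMod p))]
      refine Finset.sum_congr rfl fun s _ => ?_
      simp only [Equiv.inv_apply, inv_inv]
      by_cases h : s = 0
      · simp [h]
      · rw [← ZMod.mul_sq_pow_half p hp2 (Q s⁻¹) h]
        congr 2
        simp only [hQ]
        field_simp
        ring
    have hlin : ∑ s : ZMod p, (10 + (-6) * s) * Q s ^ (p / 2) = 0 := by
      have : ∀ s, Q s = 3 * (s - 5 * 3⁻¹) ^ 2 + (-16 * 3⁻¹) := fun s => by
        simp only [hQ]
        linear_combination (10 * s - 25 * 3⁻¹ - 3) * three_inv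
      simp_rw [this]
      rw [ZMod.sum_linear_mul_quadratic_pow p hp2]
      linear_combination (10 * 3 ^ (p / 2)) * three_inv
    simp_rw [hpt, Finset.sum_sub_distrib, ← Finset.mul_sum, hinv]
    rw [Finset.mul_sum, ← Finset.sum_sub_distrib]
    rw [Finset.sum_congr rfl fun s _ => show (10 - 3 * s) * Q s ^ (p / 2) -
      3 * (s * Q s ^ (p / 2)) = (10 + (-6) * s) * Q s ^ (p / 2) by ring, hlin]
    simp
  have hterm : ∀ n ∈ Finset.range p,
      (∑ k ∈ Finset.range (n + 1),
        (n.choose k : ZMod p) * (catalan k : ZMod p) * ((2 : ZMod p)⁻¹) ^ k) ^ 2 =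
      b n ^ 2 + (if n = p - 2 then 1 - 2 * b (p - 2) else 0) +
        (if n = p - 1 then 9 + 6 * b (p - 1) else 0) := by
    intro n hn
    rw [sum_choose_mul_catalan_eq_sum p hp3 n (Finset.mem_range.mp hn)]
    change (-b n + _) ^ 2 = _
    by_cases h1 : n = p - 2
    · rw [if_pos h1, if_pos h1, if_neg (by omega), if_neg (by omega), ← h1]; ring
    · rw [if_neg h1, if_neg h1]
      split_ifs with h2
      · rw [← h2]; ring
      · ring
  rw [Finset.sum_congr rfl hterm, Finset.sum_add_distrib, Finset.sum_add_distrib,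
    Finset.sum_ite_eq', Finset.sum_ite_eq', if_pos (Finset.mem_range.mpr (by omega)),
    if_pos (Finset.mem_range.mpr (by omega)), ZMod.sum_sq_moments p g, g_sum, corr, b_top, b_pred]
  ring
end
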